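/- Let H be a minimal feasible solution to a VC-SNDP instance with graph G, terminal set R, and demands d_{s,t} satisfying d_{s,t} ≤ 3 for all s,t ∈ R. Then there exist subtrees T₁,…,T_b of H such that H = ⋃_{i=1}^b T_i, no two of the trees share a Steiner vertex, every leaf of every tree is a terminal, and every internal vertex of every tree is a Steiner vertex. Moreover, for every terminal pair s,t ∈ R there exist d_{s,t} internally vertex-disjoint s–t paths in H such that the edge set of each tree T_i (i ∈ {1,…,b}) intersects the edge set of at most one of these paths. -/

import Mathlib

open SimpleGraph

/-- A family of `n` distinct pairwise internally vertex-disjoint `s`-`t` paths: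
any two of them only share the vertices `s` and `t`. -/
def IntDisjPaths {V : Type*} (G : SimpleGraph V) (s t : V) (n : ℕ)
    (P : Fin n → G.Walk s t) : Prop :=
  (∀ i, (P i).IsPath) ∧ ∀ i j, i ≠ j → P i ≠ P j ∧
    ∀ v, v ∈ (P i).support → v ∈ (P j).support → v = s ∨ v = t

/-- The vertex-connectivity `κ_G(s,t)`: the maximum number of pairwise
internally vertex-disjoint `s`-`t` paths. -/
noncomputable def vConn {V : Type*} (G : SimpleGraph V) (s t : V) : ℕ :=
  sSup {n | ∃ P : Fin n → G.Walk s t, IntDisjPaths G s t n P}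

/-- Feasibility for VC-SNDP: the subgraph `H` satisfies all vertex-connectivity
demands between distinct terminal pairs. -/
def VCFeasible {V : Type*} (H : SimpleGraph V) (R : Set V) (d : V → V → ℕ) : Prop :=
  ∀ s ∈ R, ∀ t ∈ R, s ≠ t → d s t ≤ vConn H s t

/-- The graph `G` with only those edges that lie inside `U`. -/
def within {M : Type*} (G : SimpleGraph M) (U : Set M) : SimpleGraph M where
  Adj x y := G.Adj x y ∧ x ∈ U ∧ y ∈ U
  symm := ⟨fun _ _ h => ⟨h.1.symm, h.2.2, h.2.1⟩⟩
  loopless := ⟨fun _ h => h.1.ne rfl⟩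

/-- The set `U` contains a vertex of `A` and a vertex of `B` joined inside `U`. -/
def Links {M : Type*} (G : SimpleGraph M) (A B U : Set M) : Prop :=
  ∃ a ∈ A, ∃ b ∈ B, a ∈ U ∧ b ∈ U ∧ (within G U).Reachable a b

/-- The set `Z` separates `A` from `B`, where `Y` is the side of `A`. -/
def Separates {M : Type*} (G : SimpleGraph M) (A B Y : Set M) (Z : Finset M) : Prop :=
  (∀ a ∈ A, a ∈ Y ∨ a ∈ Z) ∧ (∀ b ∈ B, b ∉ Y) ∧ ∀ x ∈ Y, ∀ y, G.Adj x y → y ∈ Y ∨ y ∈ Z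

theorem within_mono {M : Type*} {G G' : SimpleGraph M} {U U' : Set M} (hG : G ≤ G')
    (hU : U ⊆ U') : within G U ≤ within G' U' :=
  fun _ _ h => ⟨hG h.1, hU h.2.1, hU h.2.2⟩

theorem mem_of_reachable {M : Type*} {G : SimpleGraph M} {L : Set M}
    (hL : ∀ x ∈ L, ∀ y, G.Adj x y → y ∈ L) {a b : M} (h : G.Reachable a b) (ha : a ∈ L) :
    b ∈ L := by
  obtain ⟨w⟩ := h
  induction w with
  | nil => exact ha
  | cons h _ ih => exact ih (hL _ ha _ h)

theorem reachable_of_step {M N : Type*} {G : SimpleGraph M} {G' : SimpleGraph N} (f : M → N)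
    (hf : ∀ x y, G.Adj x y → G'.Reachable (f x) (f y)) {a b : M} (h : G.Reachable a b) :
    G'.Reachable (f a) (f b) := by
  obtain ⟨w⟩ := h
  induction w with
  | nil => exact Reachable.refl _
  | cons h _ ih => exact (hf _ _ h).trans ih

theorem Links.mono {M : Type*} {G G' : SimpleGraph M} {A B U : Set M} (hG : G ≤ G')
    (h : Links G A B U) : Links G' A B U := by
  obtain ⟨a, ha, b, hb, haU, hbU, hr⟩ := h
  exact ⟨a, ha, b, hb, haU, hbU, hr.mono (within_mono hG subset_rfl)⟩

/-- Walks inside `within G L` that start in `L` can be trimmed to `L`. -/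
theorem Links.inter {M : Type*} {G : SimpleGraph M} {A B U L : Set M} (hA : A ⊆ L) (hB : B ⊆ L)
    (h : Links (within G L) A B U) : Links (within G L) A B (U ∩ L) := by
  obtain ⟨a, ha, b, hb, haU, hbU, hr⟩ := h
  exact ⟨a, ha, b, hb, ⟨haU, hA ha⟩, ⟨hbU, hB hb⟩,
    hr.mono (SimpleGraph.le_iff_adj.2 fun x y (hxy : (within (within G L) U).Adj x y) =>
      ⟨hxy.1, ⟨hxy.2.1, hxy.1.2.1⟩, ⟨hxy.2.2, hxy.1.2.2⟩⟩)⟩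

/-- A family of disjoint sets linking `A` with a finite set `P` of the same size can be indexed
by the elements of `P`. -/
theorem exists_links_indexed {M : Type*} {G : SimpleGraph M} {A : Set M} {P : Finset M}
    {k : ℕ} (hP : P.card = k) (U : Fin k → Set M) (hd : Pairwise (Function.onFun Disjoint U))
    (hl : ∀ i, Links G A (P : Set M) (U i)) :
    ∃ W : M → Set M, (∀ z ∈ P, ∀ z' ∈ P, ∀ m, m ∈ W z → m ∈ W z' → z = z') ∧
      (∀ z ∈ P, Links G A {z} (W z)) ∧ (∀ z ∈ P, ∃ i, W z = U i) := by
  choose a ha b hb haU hbU hr using hl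
  have hinj : Function.Injective fun i => (⟨b i, hb i⟩ : P) := by
    intro i j hij
    by_contra hne
    have hij : b i = b j := by simpa using hij
    exact Set.disjoint_left.1 (hd hne) (hbU i) (hij ▸ hbU j)
  have hbij : Function.Bijective fun i => (⟨b i, hb i⟩ : P) :=
    (Fintype.bijective_iff_injective_and_card _).2 ⟨hinj, by simp [hP]⟩
  have hs : ∀ z ∈ P, ∃ i, b i = z := fun z hz => by
    obtain ⟨i, hi⟩ := hbij.2 ⟨z, hz⟩
    exact ⟨i, by simpa using hi⟩
  choose σ hσ using hs
  refine ⟨fun z => {m | ∃ hz : z ∈ P, m ∈ U (σ z hz)}, ?_, ?_, ?_⟩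
  · rintro z hz z' hz' m ⟨_, h⟩ ⟨_, h'⟩
    have : σ z hz = σ z' hz' := by
      by_contra hne
      exact Set.disjoint_left.1 (hd hne) h h'
    rw [← hσ z hz, this, hσ z' hz']
  · intro z hz
    have : {m | ∃ hz : z ∈ P, m ∈ U (σ z hz)} = U (σ z hz) := by ext; simp [hz]
    change Links G A {z} {m | ∃ hz : z ∈ P, m ∈ U (σ z hz)}
    rw [this]
    exact ⟨_, ha _, _, hσ z hz, haU _, hbU _, hr _⟩
  · intro z hz
    exact ⟨σ z hz, by ext; simp [hz]⟩

theorem Links.symm {M : Type*} {G : SimpleGraph M} {A B U : Set M} (h : Links G A B U) :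
    Links G B A U := by
  obtain ⟨a, ha, b, hb, haU, hbU, hr⟩ := h
  exact ⟨b, hb, a, ha, hbU, haU, hr.symm⟩

theorem Links.union {M : Type*} {G : SimpleGraph M} {A B U U' : Set M} {x y : M}
    (hU : Links G A {x} U) (hU' : Links G {y} B U') (hxy : x = y ∨ G.Adj x y) :
    Links G A B (U ∪ U') := by
  obtain ⟨a, ha, _, rfl, haU, hbU, hr⟩ := hU
  obtain ⟨_, rfl, b, hb, haU', hbU', hr'⟩ := hU'
  refine ⟨a, ha, b, hb, .inl haU, .inr hbU', ?_⟩
  have h1 := hr.mono (within_mono (le_refl G) (Set.subset_union_left (s := U) (t := U')))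
  have h2 := hr'.mono (within_mono (le_refl G) (Set.subset_union_right (s := U) (t := U')))
  refine h1.trans (Reachable.trans ?_ h2)
  rcases hxy with rfl | hxy
  · exact Reachable.refl _
  · exact Adj.reachable (G := within G (U ∪ U')) ⟨hxy, .inl hbU, .inr haU'⟩

open Classical in
/-- **Menger's theorem** for two vertex sets. -/
theorem exists_disjoint_links {M : Type*} [Finite M] (G : SimpleGraph M) (k : ℕ) (A B : Set M)
    (h : ∀ Y Z, Separates G A B Y Z → k ≤ Z.card) :
    ∃ U : Fin k → Set M, Pairwise (Function.onFun Disjoint U) ∧ ∀ i, Links G A B (U i) := by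
  have := Fintype.ofFinite M
  induction G using WellFoundedLT.induction generalizing A B with
  | ind G ih =>
  by_cases hG : ∃ x y, G.Adj x y
  swap
  · push Not at hG
    have hk := h (A \ B) (Finset.univ.filter fun v => v ∈ A ∧ v ∈ B)
      ⟨fun a ha => by by_cases hb : a ∈ B <;> simp [ha, hb], fun b hb => by simp [hb],
        fun x _ y hxy => (hG x y hxy).elim⟩
    obtain ⟨e⟩ : Nonempty (Fin k ↪ (Finset.univ.filter fun v => v ∈ A ∧ v ∈ B)) :=
      Function.Embedding.nonempty_of_card_le (by simpa only [Fintype.card_fin, Fintype.card_coe] using hk)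
    refine ⟨fun i => {(e i : M)}, fun i j hij => ?_, fun i => ?_⟩
    · simpa [Function.onFun, Subtype.ext_iff] using hij ∘ fun h => e.injective (Subtype.ext h)
    · have := (e i).2
      simp only [Finset.mem_filter, Finset.mem_univ, true_and] at this
      exact ⟨e i, this.1, e i, this.2, rfl, rfl, Reachable.refl _⟩
  obtain ⟨x₀, y₀, h₀⟩ := hG
  set D := G.deleteEdges {s(x₀, y₀)} with hD
  have hDle : D ≤ G := deleteEdges_le _
  have hDlt : D < G := by
    refine lt_of_le_of_ne hDle fun heq => ?_
    have : D.Adj x₀ y₀ := heq ▸ h₀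
    simp [hD] at this
  by_cases hcut : ∀ Y Z, Separates D A B Y Z → k ≤ Z.card
  · obtain ⟨U, hU, hl⟩ := ih D hDlt A B hcut
    exact ⟨U, hU, fun i => (hl i).mono hDle⟩
  push Not at hcut
  obtain ⟨Y₀, S, hsep₀, hSk⟩ := hcut
  obtain ⟨Y, hYS, hA, hB, hY⟩ : ∃ Y : Set M, (∀ v ∈ Y, v ∉ S) ∧ Separates D A B Y S := by
    refine ⟨Y₀ \ S, fun v hv => hv.2, fun a ha => ?_, fun b hb hb' => hsep₀.2.1 b hb hb'.1,
      fun x hx y hxy => ?_⟩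
    · have := hsep₀.1 a ha
      by_cases haS : a ∈ S <;> simp_all
    · have := hsep₀.2.2 x hx.1 y hxy
      by_cases hyS : y ∈ S <;> simp_all
  obtain ⟨x, y, hxy, hxY, hyY, hyS, hE⟩ : ∃ x y, G.Adj x y ∧ x ∈ Y ∧ y ∉ Y ∧ y ∉ S ∧
      ∀ v w, G.Adj v w → ¬ D.Adj v w → (v = x ∧ w = y) ∨ (v = y ∧ w = x) := by
    have hE : ∀ v w, G.Adj v w → ¬ D.Adj v w → (v = x₀ ∧ w = y₀) ∨ (v = y₀ ∧ w = x₀) := by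
      intro v w hvw hn
      have : s(v, w) = s(x₀, y₀) := by
        by_contra hne
        exact hn (deleteEdges_adj.2 ⟨hvw, hne⟩)
      simpa using this
    by_contra hcon
    push Not at hcon
    refine absurd (h Y S ⟨hA, hB, fun v hv w hvw => ?_⟩) (by omega)
    by_cases hD' : D.Adj v w
    · exact hY v hv w hD'
    by_contra hw
    push Not at hw
    obtain ⟨v', w', h1, h2, h3⟩ := hcon v w hvw hv hw.1 hw.2
    have := hE v w hvw hD'
    have := hE v' w' h1 h2
    grind
  have hxS := hYS x hxY
  have hYG : ∀ v ∈ Y, ∀ w, G.Adj v w → w ∈ Y ∨ w ∈ S ∨ (v = x ∧ w = y) := by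
    intro v hv w hvw
    by_cases hD' : D.Adj v w
    · have := hY v hv w hD'
      tauto
    · rcases hE v w hvw hD' with h' | ⟨rfl, rfl⟩
      · tauto
      · exact absurd hv hyY
  have hcard : S.card + 1 = k := by
    have := h (Y \ {x}) (insert x S) ⟨fun a ha => ?_, fun b hb hb' => hB b hb hb'.1,
      fun v hv w hvw => ?_⟩
    · rw [Finset.card_insert_of_notMem hxS] at this
      omega
    · have := hA a ha
      by_cases hax : a = x <;> simp_all
    · have := hYG v hv.1 w hvw
      have hvx : v ≠ x := hv.2
      by_cases hwx : w = x <;> simp_all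
  set L : Set M := {v | v ∈ Y ∨ v ∈ S} with hL
  set L' : Set M := {v | v ∉ Y} with hL'
  have hlt : ∀ K : Set M, ¬ (x ∈ K ∧ y ∈ K) → within G K < G := by
    intro K hK
    refine lt_of_le_of_ne (fun _ _ h => h.1) fun heq => ?_
    rw [← heq] at hxy
    exact hK hxy.2
  have hPcard : (insert x S).card = k := by rw [Finset.card_insert_of_notMem hxS, hcard]
  have hQcard : (insert y S).card = k := by rw [Finset.card_insert_of_notMem hyS, hcard]
  obtain ⟨U, hU, hlU⟩ := ih (within G L) (hlt L (by simp [hL, hyY, hyS])) A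
    ((insert x S : Finset M) : Set M) <| by
      rintro Y₁ Z₁ ⟨h1, h2, h3⟩
      refine h (Y₁ ∩ L) Z₁ ⟨fun a ha => ?_, fun b hb hb' => ?_, fun v hv w hvw => ?_⟩
      · have := h1 a ha
        have := hA a ha
        simp only [Set.mem_inter_iff, hL, Set.mem_ofPred_eq]
        tauto
      · rcases hb'.2 with h' | h'
        · exact hB b hb h'
        · exact h2 b (by simp [h']) hb'.1
      · have hvx : v ≠ x := by
          rintro rfl
          exact h2 v (by simp) hv.1
        have hvY : v ∈ Y := by
          rcases hv.2 with h' | h'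
          · exact h'
          · exact (h2 v (by simp [h']) hv.1).elim
        have hwL : w ∈ L := by
          rcases hYG v hvY w hvw with h' | h' | h'
          · exact .inl h'
          · exact .inr h'
          · exact absurd h'.1 hvx
        rcases h3 v hv.1 w ⟨hvw, hv.2, hwL⟩ with h' | h'
        · exact .inl ⟨h', hwL⟩
        · exact .inr h'
  obtain ⟨U', hU', hlU'⟩ := ih (within G L') (hlt L' (by simp [hL', hxY]))
    ((insert y S : Finset M) : Set M) B <| by
      rintro Y₁ Z₁ ⟨h1, h2, h3⟩
      have hS : ∀ w, w ∈ S ∨ w = y → w ∈ Y₁ ∨ w ∈ Z₁ := fun w hw => h1 w (by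
        simp only [Finset.coe_insert, Set.mem_insert_iff, Finset.mem_coe]; tauto)
      refine h (Y ∪ Y₁) Z₁ ⟨fun a ha => ?_, fun b hb hb' => ?_, fun v hv w hvw => ?_⟩
      · rcases hA a ha with h' | h'
        · exact .inl (.inl h')
        · have := hS a (.inl h')
          simp only [Set.mem_union]
          tauto
      · exact hb'.elim (hB b hb) (h2 b hb)
      · have key : w ∈ Y ∨ w ∈ Y₁ ∨ w ∈ Z₁ := by
          by_cases hvY : v ∈ Y
          · rcases hYG v hvY w hvw with h' | h' | h'
            · exact .inl h'
            · exact .inr (hS w (.inl h'))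
            · exact .inr (hS w (.inr h'.2))
          · by_cases hwY : w ∈ Y
            · exact .inl hwY
            · exact .inr (h3 v (hv.resolve_left hvY) w ⟨hvw, hvY, hwY⟩)
        simp only [Set.mem_union]
        tauto
  have hAL : A ⊆ L := fun a ha => hA a ha
  have hPL : ((insert x S : Finset M) : Set M) ⊆ L := fun v hv => by
    simp only [Finset.coe_insert, Set.mem_insert_iff, Finset.mem_coe] at hv
    rcases hv with rfl | hv
    · exact .inl hxY
    · exact .inr hv
  have hBL : B ⊆ L' := fun b hb => hB b hb
  have hQL : ((insert y S : Finset M) : Set M) ⊆ L' := fun v hv => by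
    simp only [Finset.coe_insert, Set.mem_insert_iff, Finset.mem_coe] at hv
    rcases hv with rfl | hv
    · exact hyY
    · exact fun hvY => hYS v hvY hv
  obtain ⟨W, hW, hlW, hWU⟩ := exists_links_indexed hPcard (fun i => U i ∩ L)
    (fun i j hij => (hU hij).mono Set.inter_subset_left Set.inter_subset_left)
    (fun i => (hlU i).inter hAL hPL)
  obtain ⟨W', hW', hlW', hWU'⟩ := exists_links_indexed hQcard (fun i => U' i ∩ L')
    (fun i j hij => (hU' hij).mono Set.inter_subset_left Set.inter_subset_left)
    (fun i => ((hlU' i).inter hQL hBL).symm)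
  have hle : ∀ K, within G K ≤ G := fun K _ _ h => h.1
  set τ : M → M := fun z => if z = x then y else z with hτ
  have hτQ : ∀ z ∈ insert x S, τ z ∈ insert y S := by
    intro z hz
    simp only [hτ]
    split_ifs with hzx
    · simp
    · simp only [Finset.mem_insert] at hz ⊢
      tauto
  have hself : ∀ z ∈ insert x S, z ∈ W z := by
    intro z hz
    obtain ⟨a, -, b, hb, -, hbW, -⟩ := hlW z hz
    exact Set.mem_singleton_iff.1 hb ▸ hbW
  have hself' : ∀ z ∈ insert y S, z ∈ W' z := by
    intro z hz
    obtain ⟨a, -, b, hb, -, hbW, -⟩ := hlW' z hz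
    exact Set.mem_singleton_iff.1 hb ▸ hbW
  have hcross : ∀ z ∈ insert x S, ∀ z' ∈ insert x S, ∀ m, m ∈ W z → m ∈ W' (τ z') → z = z' := by
    intro z hz z' hz' m hm hm'
    have hmL : m ∈ L := by
      obtain ⟨i, hi⟩ := hWU z hz
      exact (hi ▸ hm).2
    have hmL' : m ∈ L' := by
      obtain ⟨i, hi⟩ := hWU' (τ z') (hτQ z' hz')
      exact (hi ▸ hm').2
    have hmS : m ∈ S := hmL.resolve_left hmL'
    have h1 := hW z hz m (by simp [hmS]) m hm (hself m (by simp [hmS]))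
    have h2 := hW' (τ z') (hτQ z' hz') m (by simp [hmS]) m hm' (hself' m (by simp [hmS]))
    subst h1
    by_cases hz'x : z' = x
    · simp only [hτ, hz'x, if_true] at h2
      exact absurd (h2 ▸ hmS) hyS
    · simp only [hτ, hz'x, if_false] at h2
      exact h2.symm
  have hτinj : ∀ z ∈ insert x S, ∀ z' ∈ insert x S, τ z = τ z' → z = z' := by
    intro z hz z' hz' h'
    simp only [hτ] at h'
    simp only [Finset.mem_insert] at hz hz'
    split_ifs at h' with h1 h2 h2
    · rw [h1, h2]
    · exact absurd (h' ▸ hz'.resolve_left h2) hyS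
    · exact absurd (h' ▸ hz.resolve_left h1) hyS
    · exact h'
  obtain ⟨e⟩ : Nonempty (Fin k ≃ (insert x S : Finset M)) :=
    ⟨(Finset.equivFinOfCardEq hPcard).symm⟩
  refine ⟨fun i => W (e i) ∪ W' (τ (e i)), fun i j hij => ?_, fun i => ?_⟩
  · refine Set.disjoint_left.2 fun m hm hm' => hij (e.injective (Subtype.ext ?_))
    rcases hm with hm | hm <;> rcases hm' with hm' | hm'
    · exact hW _ (e i).2 _ (e j).2 m hm hm'
    · exact hcross _ (e i).2 _ (e j).2 m hm hm'
    · exact (hcross _ (e j).2 _ (e i).2 m hm' hm).symm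
    · exact hτinj _ (e i).2 _ (e j).2
        (hW' _ (hτQ _ (e i).2) _ (hτQ _ (e j).2) m hm hm')
  · refine ((hlW _ (e i).2).mono (hle L)).union
      ((hlW' _ (hτQ _ (e i).2)).mono (hle L')).symm ?_
    simp only [hτ]
    split_ifs with hx
    · rw [hx]
      exact .inr hxy
    · exact .inl rfl

/-- A separation of `s` from `t` with separator `Z`, where `Y` is the side of `s`. -/
def VCut {M : Type*} (G : SimpleGraph M) (s t : M) (Y : Set M) (Z : Finset M) : Prop :=
  s ∈ Y ∧ t ∉ Y ∧ s ∉ Z ∧ t ∉ Z ∧ ∀ x ∈ Y, ∀ y, G.Adj x y → y ∈ Y ∨ y ∈ Z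

/-- Every separator of `s` and `t` has at least `k` vertices. -/
def CutConn {M : Type*} (G : SimpleGraph M) (s t : M) (k : ℕ) : Prop :=
  ∀ Y Z, VCut G s t Y Z → k ≤ Z.card

theorem CutConn.symm {M : Type*} {G : SimpleGraph M} {s t : M} {k : ℕ}
    (h : CutConn G s t k) : CutConn G t s k := by
  rintro Y Z ⟨h1, h2, h3, h4, h5⟩
  refine h {v | v ∉ Y ∧ v ∉ Z} Z ⟨⟨h2, h4⟩, fun h => h.1 h1, h4, h3, fun x hx y hxy => ?_⟩
  by_contra hcon
  simp only [Set.mem_ofPred_eq, not_or, not_and_or, not_not] at hcon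
  have := h5 y (hcon.1.resolve_right hcon.2) x hxy.symm
  exact this.elim hx.1 hx.2

open Classical in
/-- **Menger's theorem** for two nonadjacent vertices. -/
theorem CutConn.exists_sets {M : Type*} [Finite M] {G : SimpleGraph M} {s t : M} {k : ℕ}
    (hst : s ≠ t) (hadj : ¬ G.Adj s t) (h : CutConn G s t k) :
    ∃ U : Fin k → Set M, (∀ i j, i ≠ j → ∀ m, m ∈ U i → m ∈ U j → m = s ∨ m = t) ∧
      ∀ i, s ∈ U i ∧ t ∈ U i ∧ (within G (U i)).Reachable s t := by
  set N : Set M := {v | v ≠ s ∧ v ≠ t} with hN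
  obtain ⟨U, hU, hl⟩ := exists_disjoint_links (within G N) k {v | G.Adj s v} {v | G.Adj v t} <| by
    rintro Y Z ⟨h1, h2, h3⟩
    have hns : ∀ w, w ∈ Y ∨ w ∈ Z → w ≠ t →
        w ∈ (Y \ {t}) ∪ {s} ∨ w ∈ (Z.erase s).erase t := by
      intro w hw hwt
      by_cases hws : w = s
      · exact .inl (.inr hws)
      · rcases hw with hw | hw
        · exact .inl (.inl ⟨hw, hwt⟩)
        · exact .inr (by simp [hw, hwt, hws])
    refine (h ((Y \ {t}) ∪ {s}) ((Z.erase s).erase t)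
      ⟨by simp, by simp [hst.symm], by simp, by simp, fun v hv w hvw => ?_⟩).trans
      ((Finset.card_le_card (Finset.erase_subset _ _)).trans
        (Finset.card_le_card (Finset.erase_subset _ _)))
    by_cases hvs : v = s
    · subst hvs
      exact hns w (h1 w hvw) fun hwt => hadj (hwt ▸ hvw)
    · have hvY : v ∈ Y ∧ v ≠ t := hv.resolve_right hvs
      have hwt : w ≠ t := fun hwt => h2 v (hwt ▸ hvw) hvY.1
      by_cases hws : w = s
      · exact .inl (.inr hws)
      · exact hns w (h3 v hvY.1 w ⟨hvw, ⟨hvs, hvY.2⟩, hws, hwt⟩) hwt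
  refine ⟨fun i => (U i ∩ N) ∪ {s, t}, fun i j hij m hm hm' => ?_, fun i => ⟨by simp, by simp, ?_⟩⟩
  · by_contra hcon
    have hmi : m ∈ U i := (hm.resolve_right hcon).1
    have hmj : m ∈ U j := (hm'.resolve_right hcon).1
    exact Set.disjoint_left.1 (hU hij) hmi hmj
  · obtain ⟨a, ha, b, hb, haU, hbU, hr⟩ := hl i
    have ha : G.Adj s a := ha
    have hb : G.Adj b t := hb
    have haN : a ∈ N := ⟨ha.ne', fun h => hadj (h ▸ ha)⟩
    have hbN : b ∈ N := ⟨fun h => hadj (h ▸ hb), hb.ne⟩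
    have h1 : (within G ((U i ∩ N) ∪ {s, t})).Reachable a b := hr.mono <|
      SimpleGraph.le_iff_adj.2 fun v w (hvw : (within (within G N) (U i)).Adj v w) =>
      ⟨hvw.1.1, .inl ⟨hvw.2.1, hvw.1.2.1⟩, .inl ⟨hvw.2.2, hvw.1.2.2⟩⟩
    have h0 : (within G ((U i ∩ N) ∪ {s, t})).Adj s a := ⟨ha, by simp, .inl ⟨haU, haN⟩⟩
    have h2 : (within G ((U i ∩ N) ∪ {s, t})).Adj b t := ⟨hb, .inl ⟨hbU, hbN⟩, by simp⟩
    exact h0.reachable.trans (h1.trans h2.reachable)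

/-- A corner of two crossing separations. -/
theorem CutConn.le_corner {M : Type*} [DecidableEq M] {G : SimpleGraph M} {A B S C D X : Finset M}
    {p q s t : M} {k : ℕ} (h : CutConn G s t k)
    (hA : ∀ x ∈ A, ∀ y, G.Adj x y → y ∈ A ∨ y ∈ S ∨ (x = p ∧ y = q))
    (hC : ∀ x ∈ C, ∀ y, G.Adj x y → y ∈ C ∨ y ∈ X)
    (hpX : p ∈ X) (hAS : Disjoint A S) (hCX : Disjoint C X)
    (hAB : Disjoint A B) (hBS : Disjoint B S) (hCD : Disjoint C D) (hDX : Disjoint D X)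
    (hs : s ∈ A ∩ C) (ht : t ∈ B ∨ t ∈ D) :
    k ≤ (A ∩ X).card + (S ∩ X).card + (S ∩ C).card := by
  simp only [Finset.disjoint_left] at *
  refine (h {v | v ∈ A ∩ C} ((A ∩ X) ∪ (S ∩ X) ∪ (S ∩ C))
    ⟨hs, ?_, ?_, ?_, fun x hx y hxy => ?_⟩).trans ?_
  · simp only [Set.mem_ofPred_eq, Finset.mem_inter] at *
    rintro ⟨h1, h2⟩
    rcases ht with ht | ht
    · exact hAB h1 ht
    · exact hCD h2 ht
  · simp only [Finset.mem_union, Finset.mem_inter] at *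
    have := hAS hs.1
    have := hCX hs.2
    tauto
  · simp only [Finset.mem_union, Finset.mem_inter] at *
    have h1 : t ∈ A → t ∈ B → False := fun a b => hAB a b
    have h2 : t ∈ B → t ∈ S → False := fun a b => hBS a b
    have h3 : t ∈ C → t ∈ D → False := fun a b => hCD a b
    have h4 : t ∈ D → t ∈ X → False := fun a b => hDX a b
    tauto
  · simp only [Set.mem_ofPred_eq, Finset.mem_union, Finset.mem_inter] at *
    have h1 := hA x hx.1 y hxy
    have h2 := hC x hx.2 y hxy
    have h3 : x ≠ p := by
      rintro rfl
      exact hCX hx.2 hpX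
    tauto
  · exact (Finset.card_union_le _ _).trans (Nat.add_le_add_right (Finset.card_union_le _ _) _)

/-- A separator of `u` and `v` of size at most three containing `p` and `q` cannot be tight if
`pq` is the only edge crossing a separation of `s` from `t` with fewer than `k ≤ 3` vertices. -/
theorem CutConn.uncross {M : Type*} [Fintype M] [DecidableEq M] {G : SimpleGraph M}
    {A S C X : Finset M} {p q s t u v : M} {k l : ℕ} (hk : k ≤ 3) (hl : l ≤ 3)
    (hst : CutConn G s t k) (huv : CutConn G u v l)
    (hA : ∀ x ∈ A, ∀ y, G.Adj x y → y ∈ A ∨ y ∈ S ∨ (x = p ∧ y = q))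
    (hC : ∀ x ∈ C, ∀ y, G.Adj x y → y ∈ C ∨ y ∈ X)
    (hAS : Disjoint A S) (hCX : Disjoint C X)
    (hpA : p ∈ A) (hqA : q ∉ A) (hqS : q ∉ S) (hpX : p ∈ X) (hqX : q ∈ X)
    (hsA : s ∈ A) (htA : t ∉ A) (htS : t ∉ S) (huC : u ∈ C) (hvC : v ∉ C) (hvX : v ∉ X)
    (hsp : s ≠ p) (htq : t ≠ q) (hS : S.card < k) (hX : X.card ≤ l) : False := by
  obtain ⟨B, hB⟩ : ∃ B : Finset M, ∀ x, x ∈ B ↔ x ∉ A ∧ x ∉ S :=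
    ⟨(A ∪ S)ᶜ, by simp⟩
  obtain ⟨D, hD⟩ : ∃ D : Finset M, ∀ x, x ∈ D ↔ x ∉ C ∧ x ∉ X :=
    ⟨(C ∪ X)ᶜ, by simp⟩
  have hAS' : ∀ x, x ∈ A → x ∉ S := fun _ h => Finset.disjoint_left.1 hAS h
  have hCX' : ∀ x, x ∈ C → x ∉ X := fun _ h => Finset.disjoint_left.1 hCX h
  have hB' : ∀ x ∈ B, ∀ y, G.Adj x y → y ∈ B ∨ y ∈ S ∨ (x = q ∧ y = p) := by
    intro x hx y hxy
    by_contra hcon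
    simp only [hB] at hx hcon
    push Not at hcon
    have hyA : y ∈ A := by
      by_contra hyA
      exact hcon.2.1 (hcon.1 hyA)
    have := hA y hyA x hxy.symm
    tauto
  have hD' : ∀ x ∈ D, ∀ y, G.Adj x y → y ∈ D ∨ y ∈ X := by
    intro x hx y hxy
    by_contra hcon
    simp only [hD] at hx hcon
    push Not at hcon
    have hyC : y ∈ C := by
      by_contra hyC
      exact hcon.2 (hcon.1 hyC)
    have := hC y hyC x hxy.symm
    tauto
  have hAB : Disjoint A B := Finset.disjoint_left.2 fun _ h h' => ((hB _).1 h').1 h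
  have hBS : Disjoint B S := Finset.disjoint_left.2 fun _ h => ((hB _).1 h).2
  have hCD : Disjoint C D := Finset.disjoint_left.2 fun _ h h' => ((hD _).1 h').1 h
  have hDX : Disjoint D X := Finset.disjoint_left.2 fun _ h => ((hD _).1 h).2
  have htB : t ∈ B := (hB t).2 ⟨htA, htS⟩
  have hvD : v ∈ D := (hD v).2 ⟨hvC, hvX⟩
  have hqB : q ∈ B := (hB q).2 ⟨hqA, hqS⟩
  have hXcard : (A ∩ X).card + (S ∩ X).card + (B ∩ X).card ≤ X.card := by
    rw [← Finset.card_union_of_disjoint, ← Finset.card_union_of_disjoint]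
    · exact Finset.card_le_card (by intro x; simp only [Finset.mem_union, Finset.mem_inter]; tauto)
    · refine Finset.disjoint_left.2 fun x => ?_
      simp only [Finset.mem_union, Finset.mem_inter, hB]
      tauto
    · refine Finset.disjoint_left.2 fun x => ?_
      have := hAS' x
      simp only [Finset.mem_inter]
      tauto
  have hScard : (S ∩ C).card + (S ∩ X).card + (S ∩ D).card ≤ S.card := by
    rw [← Finset.card_union_of_disjoint, ← Finset.card_union_of_disjoint]
    · exact Finset.card_le_card (by intro x; simp only [Finset.mem_union, Finset.mem_inter]; tauto)
    · refine Finset.disjoint_left.2 fun x => ?_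
      simp only [Finset.mem_union, Finset.mem_inter, hD]
      tauto
    · refine Finset.disjoint_left.2 fun x => ?_
      have := hCX' x
      simp only [Finset.mem_inter]
      tauto
  have hAX : 1 ≤ (A ∩ X).card := Finset.card_pos.2 ⟨p, by simp [hpA, hpX]⟩
  have hBX : 1 ≤ (B ∩ X).card := Finset.card_pos.2 ⟨q, by simp [hqB, hqX]⟩
  have two_le : ∀ (F : Finset M) (a b : M), a ∈ F → b ∈ F → a ≠ b → 2 ≤ F.card :=
    fun F a b ha hb hab => Finset.one_lt_card.2 ⟨a, ha, b, hb, hab⟩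
  have mem_or : ∀ x, x ∈ C ∨ x ∈ D ∨ x ∈ X := fun x => by simp only [hD]; tauto
  have mem_or' : ∀ x, x ∈ A ∨ x ∈ B ∨ x ∈ S := fun x => by simp only [hB]; tauto
  have cs : k ≤ (A ∩ X).card + (S ∩ X).card + (S ∩ C).card ∨
      k ≤ (A ∩ X).card + (S ∩ X).card + (S ∩ D).card ∨ 2 ≤ (A ∩ X).card := by
    rcases mem_or s with h | h | h
    · exact .inl (hst.le_corner hA hC hpX hAS hCX hAB hBS hCD hDX
        (Finset.mem_inter.2 ⟨hsA, h⟩) (.inl htB))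
    · exact .inr (.inl (hst.le_corner hA hD' hpX hAS hDX hAB hBS hCD.symm hCX
        (Finset.mem_inter.2 ⟨hsA, h⟩) (.inl htB)))
    · exact .inr (.inr (two_le _ s p (by simp [hsA, h]) (by simp [hpA, hpX]) hsp))
  have ct : k ≤ (B ∩ X).card + (S ∩ X).card + (S ∩ C).card ∨
      k ≤ (B ∩ X).card + (S ∩ X).card + (S ∩ D).card ∨ 2 ≤ (B ∩ X).card := by
    rcases mem_or t with h | h | h
    · exact .inl (hst.symm.le_corner hB' hC hqX hBS hCX hAB.symm hAS hCD hDX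
        (Finset.mem_inter.2 ⟨htB, h⟩) (.inl hsA))
    · exact .inr (.inl (hst.symm.le_corner hB' hD' hqX hBS hDX hAB.symm hAS hCD.symm hCX
        (Finset.mem_inter.2 ⟨htB, h⟩) (.inl hsA)))
    · exact .inr (.inr (two_le _ t q (by simp [htB, h]) (by simp [hqB, hqX]) htq))
  have cu : l ≤ (A ∩ X).card + (S ∩ X).card + (S ∩ C).card ∨
      l ≤ (B ∩ X).card + (S ∩ X).card + (S ∩ C).card ∨ 1 ≤ (S ∩ C).card := by
    rcases mem_or' u with h | h | h
    · exact .inl (huv.le_corner hA hC hpX hAS hCX hAB hBS hCD hDX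
        (Finset.mem_inter.2 ⟨h, huC⟩) (.inr hvD))
    · exact .inr (.inl (huv.le_corner hB' hC hqX hBS hCX hAB.symm hAS hCD hDX
        (Finset.mem_inter.2 ⟨h, huC⟩) (.inr hvD)))
    · exact .inr (.inr (Finset.card_pos.2 ⟨u, by simp [h, huC]⟩))
  have cv : l ≤ (A ∩ X).card + (S ∩ X).card + (S ∩ D).card ∨
      l ≤ (B ∩ X).card + (S ∩ X).card + (S ∩ D).card ∨ 1 ≤ (S ∩ D).card := by
    rcases mem_or' v with h | h | h
    · exact .inl (huv.symm.le_corner hA hD' hpX hAS hDX hAB hBS hCD.symm hCX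
        (Finset.mem_inter.2 ⟨h, hvD⟩) (.inr huC))
    · exact .inr (.inl (huv.symm.le_corner hB' hD' hqX hBS hDX hAB.symm hAS hCD.symm hCX
        (Finset.mem_inter.2 ⟨h, hvD⟩) (.inr huC)))
    · exact .inr (.inr (Finset.card_pos.2 ⟨v, by simp [h, hvD]⟩))
  omega

/-- The quotient of `H` by the fibres of `c`, in which every edge joining two vertices of `R` is
subdivided. -/
def subdivQuot {V : Type*} (H : SimpleGraph V) (R : Set V) (c : V → V) :
    SimpleGraph (V ⊕ Sym2 V) where
  Adj
    | .inl a, .inl b => a ≠ b ∧ ∃ x y, c x = a ∧ c y = b ∧ H.Adj x y ∧ ¬ (x ∈ R ∧ y ∈ R)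
    | .inl a, .inr e => e ∈ H.edgeSet ∧ (∀ z ∈ e, z ∈ R) ∧ a ∈ e
    | .inr e, .inl a => e ∈ H.edgeSet ∧ (∀ z ∈ e, z ∈ R) ∧ a ∈ e
    | .inr _, .inr _ => False
  symm := ⟨by
    rintro (a | e) (b | f) h
    · obtain ⟨hab, x, y, hx, hy, h, hR⟩ := h
      exact ⟨hab.symm, y, x, hy, hx, h.symm, fun h => hR ⟨h.2, h.1⟩⟩
    · exact h
    · exact h
    · exact h⟩
  loopless := ⟨by
    rintro (a | e) h
    · exact h.1 rfl
    · exact h⟩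

/-- The subgraph of `H` formed by the edges inside the fibres of `c`. -/
def fibreGraph {V : Type*} (H : SimpleGraph V) (c : V → V) : SimpleGraph V where
  Adj x y := H.Adj x y ∧ c x = c y
  symm := ⟨fun _ _ h => ⟨h.1.symm, h.2.symm⟩⟩
  loopless := ⟨fun _ h => h.1.ne rfl⟩

/-- The map `c` contracts connected sets of vertices outside `R` and keeps the vertices of `R`. -/
structure IsContraction {V : Type*} (H : SimpleGraph V) (R : Set V) (c : V → V) : Prop where
  map_mem : ∀ r ∈ R, c r = r
  map_notMem : ∀ v, v ∉ R → c v ∉ R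
  reachable : ∀ x y, c x = c y → (fibreGraph H c).Reachable x y

theorem IsContraction.eq_of_mem {V : Type*} {H : SimpleGraph V} {R : Set V} {c : V → V}
    (hc : IsContraction H R c) {v : V} (h : c v ∈ R) : c v = v := by
  by_cases hv : v ∈ R
  · exact hc.map_mem v hv
  · exact absurd h (hc.map_notMem v hv)

theorem isContraction_id {V : Type*} (H : SimpleGraph V) (R : Set V) : IsContraction H R id :=
  ⟨fun _ _ => rfl, fun _ h => h, fun x y h => by
    have : x = y := h
    rw [this]⟩

/-- Distinct members of a family of internally disjoint paths share no edge. -/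
theorem IntDisjPaths.eq_of_mem_edges {V : Type*} {G : SimpleGraph V} {s t : V} {n : ℕ}
    {P : Fin n → G.Walk s t} (hP : IntDisjPaths G s t n P) {i j : Fin n} {e : Sym2 V}
    (hi : e ∈ (P i).edges) (hj : e ∈ (P j).edges) : i = j := by
  by_contra hij
  obtain ⟨hne, hd⟩ := hP.2 i j hij
  have key : ∀ w : G.Walk s t, w.IsPath → s(s, t) ∈ w.edges → ∃ h : G.Adj s t,
      w = Walk.cons h Walk.nil := by
    intro w hw he
    cases w with
    | nil => simp at he
    | @cons _ y _ h q =>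
      rw [Walk.cons_isPath_iff] at hw
      rw [Walk.edges_cons, List.mem_cons] at he
      rcases he with he | he
      · have hty : t = y := by
          have := h.ne
          grind
        subst hty
        exact ⟨h, by rw [(Walk.isPath_iff_nil.1 hw.1).eq_nil]⟩
      · exact absurd (Walk.fst_mem_support_of_mem_edges q he) hw.2
  induction e with
  | h a b =>
    have hab : G.Adj a b := Walk.edges_subset_edgeSet _ hi
    have ha := hd a (Walk.fst_mem_support_of_mem_edges _ hi)
      (Walk.fst_mem_support_of_mem_edges _ hj)
    have hb := hd b (Walk.snd_mem_support_of_mem_edges _ hi)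
      (Walk.snd_mem_support_of_mem_edges _ hj)
    have hst : s(a, b) = s(s, t) := by
      have := hab.ne
      grind
    rw [hst] at hi hj
    obtain ⟨h1, h1'⟩ := key _ (hP.1 i) hi
    obtain ⟨h2, h2'⟩ := key _ (hP.1 j) hj
    exact hne (h1'.trans h2'.symm)

/-- Internally disjoint paths bound separators from below. -/
theorem IntDisjPaths.cutConn {V : Type*} {H : SimpleGraph V} {R : Set V} {s t : V} {n : ℕ}
    {P : Fin n → H.Walk s t} (hP : IntDisjPaths H s t n P) :
    CutConn (subdivQuot H R id) (.inl s) (.inl t) n := by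
  rintro Y Z ⟨hs, ht, hsZ, htZ, hY⟩
  have key : ∀ (x z : V) (w : H.Walk x z), Sum.inl x ∈ Y →
      (∀ v ∈ w.support, (Sum.inl v : V ⊕ Sym2 V) ∉ Z) →
      (∀ e ∈ w.edges, (Sum.inr e : V ⊕ Sym2 V) ∉ Z) → Sum.inl z ∈ Y := by
    intro x z w
    induction w with
    | nil => exact fun h _ _ => h
    | @cons x y _ h q ih =>
      intro hx hv he
      simp only [Walk.support_cons, Walk.edges_cons, List.mem_cons] at hv he
      refine ih ?_ (fun v hv' => hv v (.inr hv')) (fun e he' => he e (.inr he'))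
      have hyZ := hv y (.inr q.start_mem_support)
      by_cases hR : x ∈ R ∧ y ∈ R
      · have hR' : ∀ z ∈ s(x, y), z ∈ R := by
          intro z hz
          rcases Sym2.mem_iff.1 hz with rfl | rfl
          exacts [hR.1, hR.2]
        have h1 : Sum.inr s(x, y) ∈ Y :=
          (hY _ hx (.inr s(x, y)) ⟨h, hR', Sym2.mem_mk_left _ _⟩).resolve_right
            (he _ (.inl rfl))
        exact (hY _ h1 (.inl y) ⟨h, hR', Sym2.mem_mk_right _ _⟩).resolve_right hyZ
      · exact (hY _ hx (.inl y) ⟨h.ne, x, y, rfl, rfl, h, hR⟩).resolve_right hyZ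
  have hex : ∀ i, ∃ m ∈ Z, (∃ v ∈ (P i).support, m = Sum.inl v) ∨
      ∃ e ∈ (P i).edges, m = Sum.inr e := by
    intro i
    by_contra hcon
    push Not at hcon
    exact ht (key s t (P i) hs (fun v hv hZ => (hcon _ hZ).1 v hv rfl)
      (fun e he hZ => (hcon _ hZ).2 e he rfl))
  choose f hfZ hf using hex
  have hinj : Function.Injective f := by
    intro i j hij
    by_contra hne
    rcases hf i with ⟨v, hv, h1⟩ | ⟨e, he, h1⟩
    · have hvj : v ∈ (P j).support := by
        rcases hf j with ⟨w, hw, h2⟩ | ⟨e, -, h2⟩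
        · rw [← hij, h1] at h2
          exact Sum.inl_injective h2 ▸ hw
        · rw [← hij, h1] at h2
          cases h2
      rcases (hP.2 i j hne).2 v hv hvj with rfl | rfl
      · exact hsZ (h1 ▸ hfZ i)
      · exact htZ (h1 ▸ hfZ i)
    · rcases hf j with ⟨w, -, h2⟩ | ⟨e', he', h2⟩
      · rw [← hij, h1] at h2
        cases h2
      · rw [← hij, h1] at h2
        exact hne (hP.eq_of_mem_edges he (Sum.inr_injective h2 ▸ he'))
  simpa using Finset.card_le_card_of_injOn (s := Finset.univ) f (fun i _ => hfZ i) hinj.injOn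

/-- Connectivity of a contraction yields internally disjoint paths that use different fibres. -/
theorem IsContraction.exists_paths {V : Type*} [Finite V] {H : SimpleGraph V} {R : Set V}
    {c : V → V} (hc : IsContraction H R c) {s t : V} (hs : s ∈ R) (ht : t ∈ R) (hst : s ≠ t)
    {k : ℕ} (h : CutConn (subdivQuot H R c) (.inl s) (.inl t) k) :
    ∃ P : Fin k → H.Walk s t, IntDisjPaths H s t k P ∧ ∀ i j, i ≠ j →
      ∀ x ∈ (P i).support, ∀ y ∈ (P j).support, c x = c y → c x = s ∨ c x = t := by
  classical
  obtain ⟨U, hU, hr⟩ := h.exists_sets (by simpa using hst) (by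
    rintro ⟨-, x, y, hx, hy, -, hR⟩
    exact hR ⟨hc.eq_of_mem (hx ▸ hs) ▸ hx ▸ hs, hc.eq_of_mem (hy ▸ ht) ▸ hy ▸ ht⟩)
  let K : Fin k → SimpleGraph V := fun i =>
    { Adj := fun x y => H.Adj x y ∧ Sum.inl (c x) ∈ U i ∧ Sum.inl (c y) ∈ U i ∧
        (x ∈ R ∧ y ∈ R → Sum.inr s(x, y) ∈ U i)
      symm := ⟨fun x y h => ⟨h.1.symm, h.2.2.1, h.2.1, fun h' =>
        Sym2.eq_swap ▸ h.2.2.2 ⟨h'.2, h'.1⟩⟩⟩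
      loopless := ⟨fun x h => h.1.ne rfl⟩ }
  have hKH : ∀ i, K i ≤ H := fun i => SimpleGraph.le_iff_adj.2 fun x y h => h.1
  have hfib : ∀ i x y, c x = c y → Sum.inl (c x) ∈ U i → (K i).Reachable x y := by
    intro i x y hxy hx
    obtain ⟨w⟩ := hc.reachable x y hxy
    clear hxy
    induction w with
    | nil => exact Reachable.refl _
    | @cons x z y h q ih =>
      have hxz : (K i).Adj x z := ⟨h.1, hx, h.2 ▸ hx, fun hR =>
        absurd (((hc.map_mem x hR.1).symm.trans h.2).trans (hc.map_mem z hR.2)) h.1.ne⟩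
      exact hxz.reachable.trans (ih (h.2 ▸ hx))
  have hreach : ∀ i, (K i).Reachable s t := by
    intro i
    obtain ⟨hsU, htU, hr⟩ := hr i
    let Q : V ⊕ Sym2 V → Prop := fun m =>
      (∃ a, m = .inl a ∧ m ∈ U i ∧ ∀ x, c x = a → (K i).Reachable s x) ∨
      (∃ e, m = .inr e ∧ m ∈ U i ∧ ∃ x ∈ e, x ∈ R ∧ Sum.inl x ∈ U i ∧ (K i).Reachable s x)
    have hstep : ∀ m, Q m → ∀ n, (within (subdivQuot H R c) (U i)).Adj m n → Q n := by
      rintro m (⟨a, rfl, hm, hQ⟩ | ⟨e, rfl, hm, x, hxe, hxR, hxU, hQ⟩) (b | f) ⟨hadj, -, hn⟩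
      · obtain ⟨-, x, y, rfl, rfl, hxy, hR⟩ := hadj
        refine .inl ⟨_, rfl, hn, fun z hz => ?_⟩
        have hxy' : (K i).Adj x y := ⟨hxy, hm, hn, fun h => absurd h hR⟩
        exact (hQ x rfl).trans (hxy'.reachable.trans (hfib i y z hz.symm hn))
      · obtain ⟨-, hR, ha⟩ := hadj
        exact .inr ⟨f, rfl, hn, a, ha, hR a ha, hm, hQ a (hc.map_mem a (hR a ha))⟩
      · obtain ⟨he, hR, hb⟩ := hadj
        have hbR := hR b hb
        have hcb := hc.map_mem b hbR
        refine .inl ⟨b, rfl, hn, fun z hz => ?_⟩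
        have hzb : z = b := by
          have : c z ∈ R := hz ▸ hbR
          rw [← hz, hc.eq_of_mem this]
        subst hzb
        by_cases hxz : x = z
        · exact hxz ▸ hQ
        · have hez : e = s(x, z) := (Sym2.mem_and_mem_iff hxz).1 ⟨hxe, hb⟩
          subst hez
          have hxz' : (K i).Adj x z := ⟨he, (hc.map_mem x hxR).symm ▸ hxU, hcb.symm ▸ hn,
            fun _ => hm⟩
          exact hQ.trans hxz'.reachable
      · exact hadj.elim
    have hQs : Q (.inl s) := .inl ⟨s, rfl, hsU, fun x hx => by
      have : c x ∈ R := hx ▸ hs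
      rw [← hx, hc.eq_of_mem this]⟩
    have hQt := mem_of_reachable (L := {m | Q m}) hstep hr hQs
    rcases hQt with ⟨a, ha, -, hQ⟩ | ⟨e, he, -⟩
    · cases ha
      exact hQ t (hc.map_mem t ht)
    · cases he
  choose W hW using fun i => (hreach i).exists_isPath
  have hKsupp : ∀ i, ∀ x ∈ (W i).support, Sum.inl (c x) ∈ U i := by
    intro i
    have : ∀ (a b : V) (w : (K i).Walk a b), Sum.inl (c a) ∈ U i →
        ∀ x ∈ w.support, Sum.inl (c x) ∈ U i := by
      intro a b w
      induction w with
      | nil =>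
        intro ha x hx
        rw [Walk.support_nil, List.mem_singleton] at hx
        exact hx ▸ ha
      | cons h q ih =>
        intro ha x hx
        rw [Walk.support_cons, List.mem_cons] at hx
        rcases hx with rfl | hx
        · exact ha
        · exact ih h.2.2.1 x hx
    exact this s t (W i) ((hc.map_mem s hs).symm ▸ (hr i).1)
  have hcross : ∀ i j, i ≠ j → ∀ x ∈ (W i).support, ∀ y ∈ (W j).support, c x = c y →
      c x = s ∨ c x = t := by
    intro i j hij x hx y hy hxy
    simpa using hU i j hij _ (hKsupp i x hx) (hxy ▸ hKsupp j y hy)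
  have hmeet : ∀ i j, i ≠ j → ∀ v ∈ (W i).support, v ∈ (W j).support → v = s ∨ v = t := by
    intro i j hij v hv hv'
    rcases hcross i j hij v hv v hv' rfl with h | h
    · exact .inl (hc.eq_of_mem (h ▸ hs) ▸ h)
    · exact .inr (hc.eq_of_mem (h ▸ ht) ▸ h)
  refine ⟨fun i => (W i).mapLe (hKH i), ⟨fun i => (hW i).mapLe (hKH i), fun i j hij =>
    ⟨fun heq => ?_, ?_⟩⟩, ?_⟩
  · have hsupp : (W i).support = (W j).support := by
      simpa using congrArg Walk.support heq
    have hfirst : ∀ l, ∃ y, (K l).Adj s y ∧ y ∈ (W l).support := by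
      intro l
      cases hw : W l with
      | nil => exact absurd rfl hst
      | @cons _ y _ h q => exact ⟨y, h, by simp⟩
    have hedge : ∀ l, (W l).support = (W i).support → Sum.inr s(s, t) ∈ U l := by
      intro l hl
      obtain ⟨y, hy, hys⟩ := hfirst l
      rw [hl] at hys
      rcases hmeet i j hij y hys (hsupp ▸ hys) with rfl | rfl
      · exact absurd rfl hy.ne
      · exact hy.2.2.2 ⟨hs, ht⟩
    simpa using hU i j hij _ (hedge i rfl) (hedge j hsupp.symm)
  · simpa using hmeet i j hij
  · simpa using hcross

theorem CutConn.mono {M : Type*} {G G' : SimpleGraph M} {s t : M} {k l : ℕ} (hG : G ≤ G')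
    (hkl : k ≤ l) (h : CutConn G s t l) : CutConn G' s t k := fun Y Z hYZ =>
  hkl.trans (h Y Z ⟨hYZ.1, hYZ.2.1, hYZ.2.2.1, hYZ.2.2.2.1, fun x hx y hxy =>
    hYZ.2.2.2.2 x hx y (hG hxy)⟩)

open Classical in
theorem bddAbove_intDisjPaths {V : Type*} [Finite V] (H : SimpleGraph V) {s t : V} (hst : s ≠ t) :
    BddAbove {n | ∃ P : Fin n → H.Walk s t, IntDisjPaths H s t n P} := by
  have := Fintype.ofFinite V
  refine ⟨(Finset.univ.filter fun m : V ⊕ Sym2 V => m ≠ .inl s ∧ m ≠ .inl t).card, ?_⟩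
  rintro n ⟨P, hP⟩
  refine (hP.cutConn (R := Set.univ)) {.inl s} _ ⟨rfl, ?_, by simp, by simp, ?_⟩
  · simpa using hst.symm
  · rintro x rfl y hxy
    have hys : y ≠ .inl s := hxy.ne'
    have hyt : y ≠ .inl t := by
      rintro rfl
      obtain ⟨-, x, y, -, -, -, h⟩ := hxy
      exact h ⟨trivial, trivial⟩
    exact .inr (by simp [hys, hyt])

theorem cutConn_of_le_vConn {V : Type*} [Finite V] {H : SimpleGraph V} {R : Set V} {s t : V}
    (hst : s ≠ t) {k : ℕ} (h : k ≤ vConn H s t) :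
    CutConn (subdivQuot H R id) (.inl s) (.inl t) k := by
  obtain ⟨P, hP⟩ := Nat.sSup_mem (s := {n | ∃ P : Fin n → H.Walk s t, IntDisjPaths H s t n P})
    ⟨0, Fin.elim0, fun i => i.elim0, fun i => i.elim0⟩ (bddAbove_intDisjPaths H hst)
  exact hP.cutConn.mono (le_refl _) h

/-- The quotient of `H` by the fibres of `c` satisfies all connectivity demands. -/
def QuotFeasible {V : Type*} (H : SimpleGraph V) (R : Set V) (d : V → V → ℕ) (c : V → V) : Prop :=
  ∀ s ∈ R, ∀ t ∈ R, s ≠ t → CutConn (subdivQuot H R c) (.inl s) (.inl t) (d s t)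

theorem IsContraction.feasible {V : Type*} [Finite V] {H : SimpleGraph V} {R : Set V}
    {d : V → V → ℕ} {c : V → V} (hc : IsContraction H R c) (h : QuotFeasible H R d c) :
    VCFeasible H R d := by
  intro s hs t ht hst
  obtain ⟨P, hP, -⟩ := hc.exists_paths hs ht hst (h s hs t ht hst)
  exact le_csSup (bddAbove_intDisjPaths H hst) ⟨P, hP⟩

open Classical in
/-- In a minimal feasible graph, an edge of the quotient outside `R` can be contracted. -/
theorem IsContraction.merge {V : Type*} [Finite V] {H : SimpleGraph V} {R : Set V}
    {d : V → V → ℕ} {c : V → V} (hd : ∀ s ∈ R, ∀ t ∈ R, d s t ≤ 3)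
    (hmin : ∀ e ∈ H.edgeSet, ¬ VCFeasible (H.deleteEdges {e}) R d)
    (hc : IsContraction H R c) (hq : QuotFeasible H R d c) {p q : V} (hpq : H.Adj p q)
    (hp : p ∉ R) (hqR : q ∉ R) (hcpq : c p ≠ c q) :
    IsContraction H R (fun v => if c v = c q then c p else c v) ∧
      QuotFeasible H R d (fun v => if c v = c q then c p else c v) := by
  have := Fintype.ofFinite V
  have hcp := hc.map_notMem p hp
  have hcq := hc.map_notMem q hqR
  set c' : V → V := fun v => if c v = c q then c p else c v with hc'
  have hRq : ∀ r ∈ R, r ≠ c q := fun r hr h => hcq (h ▸ hr)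
  have hRp : ∀ r ∈ R, r ≠ c p := fun r hr h => hcp (h ▸ hr)
  refine ⟨⟨fun r hr => ?_, fun v hv => ?_, ?_⟩, ?_⟩
  · simp only [hc', hc.map_mem r hr]
    rw [if_neg (hRq r hr)]
  · simp only [hc']
    split_ifs
    · exact hcp
    · exact hc.map_notMem v hv
  · have hle : fibreGraph H c ≤ fibreGraph H c' :=
      SimpleGraph.le_iff_adj.2 fun x y h => ⟨h.1, by simp only [hc', h.2]⟩
    have hpq' : (fibreGraph H c').Reachable p q :=
      Adj.reachable (G := fibreGraph H c') ⟨hpq, by simp [hc']⟩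
    have key : ∀ x y, c x = c y → (fibreGraph H c').Reachable x y :=
      fun x y h => (hc.reachable x y h).mono hle
    intro x y hxy
    simp only [hc'] at hxy
    split_ifs at hxy with hx hy hy
    · exact key x y (hx.trans hy.symm)
    · exact (key x q hx).trans (hpq'.symm.trans (key p y hxy))
    · exact (key x p hxy).trans (hpq'.trans (key q y hy.symm))
    · exact key x y hxy
  -- a small separator after deleting `pq`
  have hcdel : IsContraction (H.deleteEdges {s(p, q)}) R c :=
    ⟨hc.map_mem, hc.map_notMem, fun x y hxy => (hc.reachable x y hxy).mono <|
      SimpleGraph.le_iff_adj.2 fun x y (h : (fibreGraph H c).Adj x y) => ⟨deleteEdges_adj.2 ⟨h.1, fun he => by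
        have hc2 := h.2
        rcases Sym2.eq_iff.1 (Set.mem_singleton_iff.1 he) with ⟨rfl, rfl⟩ | ⟨rfl, rfl⟩
        · exact hcpq hc2
        · exact hcpq hc2.symm⟩, h.2⟩⟩
  have hnf : ¬ QuotFeasible (H.deleteEdges {s(p, q)}) R d c :=
    fun h => hmin s(p, q) hpq (hcdel.feasible h)
  simp only [QuotFeasible, CutConn] at hnf
  push Not at hnf
  obtain ⟨s, hs, t, ht, hst, Y₀, S, ⟨hsY, htY, hsS, htS, hY₀⟩, hS⟩ := hnf
  set Γ := subdivQuot H R c with hΓ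
  have hdel : ∀ m n, Γ.Adj m n → (subdivQuot (H.deleteEdges {s(p, q)}) R c).Adj m n ∨
      (m = .inl (c p) ∧ n = .inl (c q)) ∨ (m = .inl (c q) ∧ n = .inl (c p)) := by
    have hRe : ∀ e : Sym2 V, e ∈ H.edgeSet → (∀ z ∈ e, z ∈ R) →
        e ∈ (H.deleteEdges {s(p, q)}).edgeSet := by
      intro e he hR
      rw [edgeSet_deleteEdges]
      exact ⟨he, fun h => hp (hR p (Set.mem_singleton_iff.1 h ▸ Sym2.mem_mk_left p q))⟩
    rintro (a | e) (b | f) h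
    · obtain ⟨hab, x, y, hx, hy, hxy, hR⟩ := h
      by_cases he : s(x, y) = s(p, q)
      · rcases Sym2.eq_iff.1 he with ⟨rfl, rfl⟩ | ⟨rfl, rfl⟩
        · exact .inr (.inl ⟨by rw [hx], by rw [hy]⟩)
        · exact .inr (.inr ⟨by rw [hx], by rw [hy]⟩)
      · exact .inl ⟨hab, x, y, hx, hy, deleteEdges_adj.2 ⟨hxy, he⟩, hR⟩
    · exact .inl ⟨hRe f h.1 h.2.1, h.2⟩
    · exact .inl ⟨hRe e h.1 h.2.1, h.2⟩
    · exact h.elim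
  obtain ⟨A, hA⟩ : ∃ A : Finset (V ⊕ Sym2 V), ∀ m, m ∈ A ↔ m ∈ Y₀ ∧ m ∉ S :=
    ⟨Finset.univ.filter fun m => m ∈ Y₀ ∧ m ∉ S, by simp⟩
  have hAcl : ∀ m ∈ A, ∀ n, Γ.Adj m n → n ∈ A ∨ n ∈ S ∨
      (m = .inl (c p) ∧ n = .inl (c q)) ∨ (m = .inl (c q) ∧ n = .inl (c p)) := by
    intro m hm n hmn
    rcases hdel m n hmn with h | h
    · have := hY₀ m ((hA m).1 hm).1 n h
      rw [hA]
      tauto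
    · exact .inr (.inr h)
  have hsA : Sum.inl s ∈ A := (hA _).2 ⟨hsY, hsS⟩
  have htA : Sum.inl t ∉ A := fun h => htY ((hA _).1 h).1
  have hAS : Disjoint A S := Finset.disjoint_left.2 fun _ h => ((hA _).1 h).2
  have hside : (Sum.inl (c p) ∈ A ∧ Sum.inl (c q) ∉ A ∧ Sum.inl (c q) ∉ S) ∨
      (Sum.inl (c q) ∈ A ∧ Sum.inl (c p) ∉ A ∧ Sum.inl (c p) ∉ S) := by
    by_contra hcon
    refine absurd (hq s hs t ht hst {m | m ∈ A} S ⟨hsA, htA, hsS, htS, fun m hm n hmn => ?_⟩)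
      (not_le.2 hS)
    have hm : m ∈ A := hm
    change n ∈ A ∨ n ∈ S
    rcases hAcl m hm n hmn with h | h | ⟨rfl, rfl⟩ | ⟨rfl, rfl⟩ <;> tauto
  -- a small separator after contracting `pq`
  intro u hu v hv huv Y' Z ⟨huY, hvY, huZ, hvZ, hY'⟩
  by_contra hZ
  push Not at hZ
  let μ : V ⊕ Sym2 V → V ⊕ Sym2 V := Sum.map (fun a => if a = c q then c p else a) id
  have hμR : ∀ r ∈ R, μ (.inl r) = .inl r := fun r hr => by
    simp [μ, hRq r hr]
  have hμadj : ∀ m n, Γ.Adj m n → μ m = μ n ∨ (subdivQuot H R c').Adj (μ m) (μ n) := by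
    rintro (a | e) (b | f) h
    · obtain ⟨-, x, y, rfl, rfl, hxy, hR⟩ := h
      by_cases hxy' : c' x = c' y
      · exact .inl (congrArg Sum.inl hxy')
      · exact .inr ⟨hxy', x, y, rfl, rfl, hxy, hR⟩
    · rw [hμR a (h.2.1 a h.2.2)]
      exact .inr h
    · rw [hμR b (h.2.1 b h.2.2)]
      exact .inr h
    · exact h.elim
  have hμinj : ∀ m n, μ m = μ n → m = n ∨ (m = .inl (c p) ∧ n = .inl (c q)) ∨
      (m = .inl (c q) ∧ n = .inl (c p)) := by
    rintro (a | e) (b | f) h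
    · simp only [μ, Sum.map_inl, Sum.inl.injEq] at h ⊢
      split_ifs at h with h1 h2 h2
      · exact .inl (h1.trans h2.symm)
      · exact .inr (.inr ⟨h1, h.symm⟩)
      · exact .inr (.inl ⟨h, h2⟩)
      · exact .inl h
    · simp [μ] at h
    · simp [μ] at h
    · simp only [μ, Sum.map_inr, id, Sum.inr.injEq] at h
      exact .inl (by rw [h])
  have hμp : μ (.inl (c p)) = .inl (c p) := by simp [μ]
  have hμq : μ (.inl (c q)) = .inl (c p) := by simp [μ]
  obtain ⟨X, hX⟩ : ∃ X : Finset (V ⊕ Sym2 V), ∀ m, m ∈ X ↔ μ m ∈ Z :=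
    ⟨Finset.univ.filter fun m => μ m ∈ Z, by simp⟩
  obtain ⟨C, hC⟩ : ∃ C : Finset (V ⊕ Sym2 V), ∀ m, m ∈ C ↔ μ m ∈ Y' ∧ μ m ∉ Z :=
    ⟨Finset.univ.filter fun m => μ m ∈ Y' ∧ μ m ∉ Z, by simp⟩
  have hCcl : ∀ m ∈ C, ∀ n, Γ.Adj m n → n ∈ C ∨ n ∈ X := by
    intro m hm n hmn
    rw [hC] at hm
    rw [hC, hX]
    rcases hμadj m n hmn with h | h
    · exact .inl (h ▸ hm)
    · have := hY' _ hm.1 _ h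
      tauto
  have huC : Sum.inl u ∈ C := (hC _).2 (by rw [hμR u hu]; exact ⟨huY, huZ⟩)
  have hvC : Sum.inl v ∉ C := fun h => hvY (by rw [← hμR v hv]; exact ((hC _).1 h).1)
  have huX : Sum.inl u ∉ X := fun h => huZ (by rw [← hμR u hu]; exact (hX _).1 h)
  have hvX : Sum.inl v ∉ X := fun h => hvZ (by rw [← hμR v hv]; exact (hX _).1 h)
  have hCX : Disjoint C X := Finset.disjoint_left.2 fun _ h h' => ((hC _).1 h).2 ((hX _).1 h')
  have hpZ : Sum.inl (c p) ∈ Z := by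
    by_contra hpZ
    have hle : X.card ≤ Z.card := by
      refine Finset.card_le_card_of_injOn μ (fun m hm => (hX m).1 hm) fun m hm n hn hmn => ?_
      have hm := (hX m).1 hm
      have hn := (hX n).1 hn
      rcases hμinj m n hmn with h | ⟨rfl, rfl⟩ | ⟨rfl, rfl⟩
      · exact h
      · exact absurd (hμp ▸ hm) hpZ
      · exact absurd (hμp ▸ hn) hpZ
    have := hq u hu v hv huv {m | m ∈ C} X ⟨huC, hvC, huX, hvX, hCcl⟩
    omega
  have hpX : Sum.inl (c p) ∈ X := (hX _).2 (hμp.symm ▸ hpZ)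
  have hqX : Sum.inl (c q) ∈ X := (hX _).2 (hμq.symm ▸ hpZ)
  have hXcard : X.card ≤ d u v := by
    have hle : (X.erase (.inl (c q))).card ≤ Z.card := by
      refine Finset.card_le_card_of_injOn μ
        (fun m hm => (hX m).1 (Finset.mem_of_mem_erase hm)) fun m hm n hn hmn => ?_
      rcases hμinj m n hmn with h | ⟨rfl, rfl⟩ | ⟨rfl, rfl⟩
      · exact h
      · exact absurd rfl (Finset.ne_of_mem_erase hn)
      · exact absurd rfl (Finset.ne_of_mem_erase hm)
    rw [Finset.card_erase_of_mem hqX] at hle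
    omega
  have hne : ∀ r ∈ R, ∀ a, a ∉ R → (Sum.inl r : V ⊕ Sym2 V) ≠ .inl a := by
    rintro r hr a ha h
    exact ha (Sum.inl_injective h ▸ hr)
  rcases hside with ⟨h1, h2, h3⟩ | ⟨h1, h2, h3⟩
  · refine CutConn.uncross (hd s hs t ht) (hd u hu v hv) (hq s hs t ht hst) (hq u hu v hv huv)
      (fun m hm n hmn => ?_) hCcl hAS hCX h1 h2 h3 hpX hqX hsA htA htS huC hvC hvX
      (hne s hs _ hcp) (hne t ht _ hcq) hS hXcard
    rcases hAcl m hm n hmn with h | h | h | ⟨rfl, rfl⟩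
    · exact .inl h
    · exact .inr (.inl h)
    · exact .inr (.inr h)
    · exact absurd hm h2
  · refine CutConn.uncross (hd s hs t ht) (hd u hu v hv) (hq s hs t ht hst) (hq u hu v hv huv)
      (fun m hm n hmn => ?_) hCcl hAS hCX h1 h2 h3 hqX hpX hsA htA htS huC hvC hvX
      (hne s hs _ hcq) (hne t ht _ hcp) hS hXcard
    rcases hAcl m hm n hmn with h | h | ⟨rfl, rfl⟩ | h
    · exact .inl h
    · exact .inr (.inl h)
    · exact absurd hm h2
    · exact .inr (.inr h)

open Classical in
/-- In a minimal feasible graph all connected sets of vertices outside `R` can be contracted. -/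
theorem exists_maximal_contraction {V : Type*} [Finite V] {H : SimpleGraph V} {R : Set V}
    {d : V → V → ℕ} (hd : ∀ s ∈ R, ∀ t ∈ R, d s t ≤ 3) (hfeas : VCFeasible H R d)
    (hmin : ∀ e ∈ H.edgeSet, ¬ VCFeasible (H.deleteEdges {e}) R d) :
    ∃ c, IsContraction H R c ∧ QuotFeasible H R d c ∧
      ∀ p q, H.Adj p q → p ∉ R → q ∉ R → c p = c q := by
  have := Fintype.ofFinite V
  obtain ⟨c, hc, hcmin⟩ := Finset.exists_min_image
    (Finset.univ.filter fun c : V → V => IsContraction H R c ∧ QuotFeasible H R d c)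
    (fun c => (Finset.univ.image c).card)
    ⟨id, by
      simp only [Finset.mem_filter, Finset.mem_univ, true_and]
      exact ⟨isContraction_id H R, fun s hs t ht hst =>
        cutConn_of_le_vConn hst (hfeas s hs t ht hst)⟩⟩
  simp only [Finset.mem_filter, Finset.mem_univ, true_and] at hc hcmin
  refine ⟨c, hc.1, hc.2, fun p q hpq hp hq => ?_⟩
  by_contra hne
  have hle := hcmin _ (hc.1.merge hd hmin hc.2 hpq hp hq hne)
  have hsub : Finset.univ.image (fun v => if c v = c q then c p else c v) ⊆
      (Finset.univ.image c).erase (c q) := by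
    intro a ha
    obtain ⟨v, -, rfl⟩ := Finset.mem_image.1 ha
    simp only [Finset.mem_erase, Finset.mem_image, Finset.mem_univ, true_and]
    split_ifs with h
    · exact ⟨hne, p, rfl⟩
    · exact ⟨h, v, rfl⟩
  have h1 := Finset.card_le_card hsub
  have h2 := Finset.card_erase_lt_of_mem
    (Finset.mem_image_of_mem c (Finset.mem_univ q))
  omega

/-- A minimal graph has no edge whose deletion changes neither the fibres nor the quotient. -/
theorem IsContraction.not_delete {V : Type*} [Finite V] {H : SimpleGraph V} {R : Set V}
    {d : V → V → ℕ} {c : V → V}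
    (hmin : ∀ e ∈ H.edgeSet, ¬ VCFeasible (H.deleteEdges {e}) R d)
    (hc : IsContraction H R c) (hq : QuotFeasible H R d c) {x y : V} (hxy : H.Adj x y)
    (hR : ¬ (x ∈ R ∧ y ∈ R))
    (hfib : c x = c y → (fibreGraph (H.deleteEdges {s(x, y)}) c).Reachable x y)
    (hquot : c x ≠ c y → ∃ x' y', c x' = c x ∧ c y' = c y ∧ H.Adj x' y' ∧
      ¬ (x' ∈ R ∧ y' ∈ R) ∧ s(x', y') ≠ s(x, y)) : False := by
  refine hmin s(x, y) hxy (IsContraction.feasible (c := c)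
    ⟨hc.map_mem, hc.map_notMem, fun u v huv => ?_⟩
    fun s hs t ht hst => (hq s hs t ht hst).mono ?_ (le_refl _))
  · refine reachable_of_step id (fun u v huv => ?_) (hc.reachable u v huv)
    by_cases he : s(u, v) = s(x, y)
    · have h2 := huv.2
      rcases Sym2.eq_iff.1 he with ⟨rfl, rfl⟩ | ⟨rfl, rfl⟩
      · exact hfib h2
      · exact (hfib h2.symm).symm
    · exact Adj.reachable (G := fibreGraph (H.deleteEdges {s(x, y)}) c)
        ⟨deleteEdges_adj.2 ⟨huv.1, he⟩, huv.2⟩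
  · have hRe : ∀ e : Sym2 V, e ∈ H.edgeSet → (∀ z ∈ e, z ∈ R) →
        e ∈ (H.deleteEdges {s(x, y)}).edgeSet := by
      intro e he hR'
      rw [edgeSet_deleteEdges]
      refine ⟨he, fun h => hR ?_⟩
      have h := Set.mem_singleton_iff.1 h
      exact ⟨hR' x (h ▸ Sym2.mem_mk_left x y), hR' y (h ▸ Sym2.mem_mk_right x y)⟩
    refine SimpleGraph.le_iff_adj.2 ?_
    rintro (a | e) (b | f) h
    · obtain ⟨hab, u, v, rfl, rfl, huv, hR'⟩ := h
      refine ⟨hab, ?_⟩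
      by_cases he : s(u, v) = s(x, y)
      · rcases Sym2.eq_iff.1 he with ⟨rfl, rfl⟩ | ⟨rfl, rfl⟩
        · obtain ⟨x', y', h1, h2, h3, h4, h5⟩ := hquot hab
          exact ⟨x', y', h1, h2, deleteEdges_adj.2 ⟨h3, h5⟩, h4⟩
        · obtain ⟨x', y', h1, h2, h3, h4, h5⟩ := hquot hab.symm
          exact ⟨y', x', h2, h1, deleteEdges_adj.2 ⟨h3.symm, fun he => h5 <|
            Sym2.eq_swap.trans (Set.mem_singleton_iff.1 he)⟩, fun h => h4 ⟨h.2, h.1⟩⟩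
      · exact ⟨u, v, rfl, rfl, deleteEdges_adj.2 ⟨huv, he⟩, hR'⟩
    · exact ⟨hRe f h.1 h.2.1, h.2⟩
    · exact ⟨hRe e h.1 h.2.1, h.2⟩
    · exact h.elim

open Classical in
/-- In a minimal feasible graph a vertex outside `R` is not a leaf. -/
theorem not_leaf {V : Type*} [Finite V] {H : SimpleGraph V} {R : Set V} {d : V → V → ℕ}
    (hfeas : VCFeasible H R d)
    (hmin : ∀ e ∈ H.edgeSet, ¬ VCFeasible (H.deleteEdges {e}) R d) {v x : V} (hv : v ∉ R)
    (hvx : H.Adj v x) (huniq : ∀ y, H.Adj v y → y = x) : False := by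
  refine hmin s(v, x) hvx (IsContraction.feasible (isContraction_id _ R) ?_)
  rintro s hs t ht hst Y Z ⟨hsY, htY, hsZ, htZ, hY⟩
  have hsv : (Sum.inl s : V ⊕ Sym2 V) ≠ .inl v := fun h => hv (Sum.inl_injective h ▸ hs)
  have htv : (Sum.inl t : V ⊕ Sym2 V) ≠ .inl v := fun h => hv (Sum.inl_injective h ▸ ht)
  have hnbr : ∀ m, (subdivQuot H R id).Adj (.inl v) m → m = .inl x := by
    rintro (b | f) h
    · obtain ⟨-, u, w, rfl, rfl, huw, -⟩ := h
      exact congrArg Sum.inl (huniq _ huw)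
    · exact absurd (h.2.1 v h.2.2) hv
  have hother : ∀ m n, (subdivQuot H R id).Adj m n → m ≠ .inl v → n ≠ .inl v →
      (subdivQuot (H.deleteEdges {s(v, x)}) R id).Adj m n := by
    have hRe : ∀ e : Sym2 V, e ∈ H.edgeSet → (∀ z ∈ e, z ∈ R) →
        e ∈ (H.deleteEdges {s(v, x)}).edgeSet := by
      intro e he hR
      rw [edgeSet_deleteEdges]
      exact ⟨he, fun h => hv (hR v (Set.mem_singleton_iff.1 h ▸ Sym2.mem_mk_left v x))⟩
    rintro (a | e) (b | f) h hm hn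
    · obtain ⟨hab, u, w, rfl, rfl, huw, hR⟩ := h
      refine ⟨hab, u, w, rfl, rfl, deleteEdges_adj.2 ⟨huw, fun he => ?_⟩, hR⟩
      rcases Sym2.eq_iff.1 (Set.mem_singleton_iff.1 he) with ⟨rfl, -⟩ | ⟨-, rfl⟩
      · exact hm rfl
      · exact hn rfl
    · exact ⟨hRe f h.1 h.2.1, h.2⟩
    · exact ⟨hRe e h.1 h.2.1, h.2⟩
    · exact h.elim
  have hconn := cutConn_of_le_vConn (R := R) hst (hfeas s hs t ht hst)
  by_cases hx : (Sum.inl x : V ⊕ Sym2 V) ∈ Y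
  · refine hconn (insert (.inl v) Y) Z ⟨.inr hsY, fun h => h.elim htv htY, hsZ, htZ,
      fun m hm n hmn => ?_⟩
    by_cases hnv : n = .inl v
    · exact .inl (.inl hnv)
    by_cases hmv : m = .inl v
    · subst hmv
      exact .inl (.inr (hnbr n hmn ▸ hx))
    · have := hY m (hm.resolve_left hmv) n (hother m n hmn hmv hnv)
      exact this.imp .inr id
  · refine hconn (Y \ {.inl v}) Z ⟨⟨hsY, hsv⟩, fun h => htY h.1, hsZ, htZ,
      fun m hm n hmn => ?_⟩
    by_cases hnv : n = .inl v
    · subst hnv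
      exact absurd (hnbr m hmn.symm ▸ hm.1) hx
    · have := hY m hm.1 n (hother m n hmn hm.2 hnv)
      exact this.imp (fun h => ⟨h, hnv⟩) id

/-- The subgraph of all edges of `H` with an end in the fibre of `c` over `a`. -/
def fibreSubgraph {V : Type*} (H : SimpleGraph V) (c : V → V) (a : V) : H.Subgraph where
  verts := {v | c v = a ∨ ∃ y, c y = a ∧ H.Adj v y}
  Adj x y := H.Adj x y ∧ (c x = a ∨ c y = a)
  adj_sub h := h.1
  edge_vert h := h.2.elim Or.inl fun hy => Or.inr ⟨_, hy, h.1⟩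
  symm := ⟨fun _ _ h => ⟨h.1.symm, h.2.symm⟩⟩

/-- The subgraph of `H` with the single edge `e`. -/
def edgeSubgraph {V : Type*} (H : SimpleGraph V) (e : Sym2 V) (he : e ∈ H.edgeSet) :
    H.Subgraph where
  verts := {v | v ∈ e}
  Adj x y := s(x, y) = e
  adj_sub h := by
    subst h
    exact he
  edge_vert h := h ▸ Sym2.mem_mk_left _ _
  symm := ⟨fun _ _ h => Sym2.eq_swap.trans h⟩

theorem isTree_edgeSubgraph {V : Type*} {H : SimpleGraph V} {e : Sym2 V} (he : e ∈ H.edgeSet) :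
    (edgeSubgraph H e he).coe.IsTree := by
  induction e with | _ u v => ?_
  refine ⟨connected_iff_exists_forall_reachable _ |>.2
    ⟨⟨u, Sym2.mem_mk_left u v⟩, ?_⟩, isAcyclic_iff_forall_adj_isBridge.2 ?_⟩
  · rintro ⟨w, hw⟩
    rcases Sym2.mem_iff.1 hw with rfl | rfl
    · exact Reachable.refl _
    · exact Adj.reachable (G := (edgeSubgraph H s(u, w) he).coe) rfl
  · rintro ⟨x, hx⟩ ⟨y, hy⟩ (hxy : s(x, y) = s(u, v))
    refine isBridge_iff.2 fun h => ?_
    have hne : x ≠ y := ((edgeSubgraph H s(u, v) he).adj_sub hxy).ne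
    refine hne (congrArg Subtype.val (Set.mem_singleton_iff.1
      (mem_of_reachable (L := {⟨x, hx⟩}) ?_ h rfl))).symm
    rintro _ rfl ⟨z, hz⟩ hz'
    obtain ⟨h1, h2⟩ := deleteEdges_adj.1 hz'
    have h3 : s(x, z) = s(x, y) := Eq.trans h1 hxy.symm
    obtain rfl := Sym2.congr_right.1 h3
    exact absurd rfl h2

theorem mem_of_mem_fibreSubgraph {V : Type*} {H : SimpleGraph V} {R : Set V} {c : V → V}
    {a v : V} (hc : IsContraction H R c)
    (hS : ∀ p q, H.Adj p q → p ∉ R → q ∉ R → c p = c q) (ha : a ∉ R)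
    (hv : v ∈ (fibreSubgraph H c a).verts) (hvR : v ∉ R) : c v = a := by
  obtain hv | ⟨y, hy, hvy⟩ := hv
  · exact hv
  · refine (hS v y hvy hvR fun hyR => ha ?_).trans hy
    rw [← hy, hc.map_mem y hyR]
    exact hyR

theorem IsContraction.notMem {V : Type*} {H : SimpleGraph V} {R : Set V} {c : V → V} {a v : V}
    (hc : IsContraction H R c) (ha : a ∉ R) (hv : c v = a) : v ∉ R := fun h =>
  ha (hv ▸ (hc.map_mem v h).symm ▸ h)

open Classical in
theorem isTree_fibreSubgraph {V : Type*} {H : SimpleGraph V} {R : Set V} {c : V → V} {a : V}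
    (hc : IsContraction H R c) (hS : ∀ p q, H.Adj p q → p ∉ R → q ∉ R → c p = c q)
    (hleaf : ∀ r x y, r ∈ R → x ∉ R → y ∉ R → c x = c y → H.Adj r x → H.Adj r y → x = y)
    (hbridge : ∀ x y, (fibreGraph H c).Adj x y →
      ¬ ((fibreGraph H c).deleteEdges {s(x, y)}).Reachable x y)
    (ha : a ∈ Set.range c) (haR : a ∉ R) : (fibreSubgraph H c a).coe.IsTree := by
  obtain ⟨v₀, hv₀⟩ := ha
  refine ⟨connected_iff_exists_forall_reachable _ |>.2 ⟨⟨v₀, Or.inl hv₀⟩, ?_⟩,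
    isAcyclic_iff_forall_adj_isBridge.2 ?_⟩
  · have hin : ∀ v (hv : c v = a),
        (fibreSubgraph H c a).coe.Reachable ⟨v₀, Or.inl hv₀⟩ ⟨v, Or.inl hv⟩ := by
      intro v hv
      have h := reachable_of_step (G' := (fibreSubgraph H c a).coe)
        (fun w => if hw : c w = a then ⟨w, Or.inl hw⟩ else ⟨v₀, Or.inl hv₀⟩) (fun x y hxy => ?_)
        (hc.reachable v₀ v (hv₀.trans hv.symm))
      · simpa only [dif_pos hv₀, dif_pos hv] using h
      · by_cases hx : c x = a
        · have hy : c y = a := hxy.2.symm.trans hx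
          simp only [dif_pos hx, dif_pos hy]
          exact Adj.reachable (G := (fibreSubgraph H c a).coe) ⟨hxy.1, Or.inl hx⟩
        · have hy : ¬ c y = a := fun h => hx (hxy.2.trans h)
          simp only [dif_neg hx, dif_neg hy]
          exact Reachable.refl _
    rintro ⟨v, hv | ⟨y, hy, hvy⟩⟩
    · exact hin v hv
    · exact (hin y hy).trans
        (Adj.reachable (G := (fibreSubgraph H c a).coe) ⟨hvy.symm, Or.inl hy⟩)
  · -- an edge leaving the fibre ends in a leaf
    have hout : ∀ x y (hx : x ∈ (fibreSubgraph H c a).verts)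
        (hy : y ∈ (fibreSubgraph H c a).verts), H.Adj x y → c x = a → c y ≠ a →
        ¬ ((fibreSubgraph H c a).coe.deleteEdges {s(⟨x, hx⟩, ⟨y, hy⟩)}).Reachable
          ⟨y, hy⟩ ⟨x, hx⟩ := by
      intro x y hx hy hxy hxa hya h
      have hyR : y ∈ R := by
        by_contra hyR
        exact hya (mem_of_mem_fibreSubgraph hc hS haR hy hyR)
      refine hxy.ne (congrArg Subtype.val (Set.mem_singleton_iff.1
        (mem_of_reachable (L := {⟨y, hy⟩}) ?_ h rfl)))
      rintro _ rfl ⟨z, hz⟩ hz'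
      obtain ⟨h1, h2⟩ := deleteEdges_adj.1 hz'
      have h1 : H.Adj y z ∧ (c y = a ∨ c z = a) := h1
      have hza := h1.2.resolve_left hya
      obtain rfl := hleaf y z x hyR (hc.notMem haR hza) (hc.notMem haR hxa)
        (hza.trans hxa.symm) h1.1 hxy.symm
      exact absurd Sym2.eq_swap h2
    rintro ⟨x, hx⟩ ⟨y, hy⟩ hxy
    have hxy : H.Adj x y ∧ (c x = a ∨ c y = a) := hxy
    refine isBridge_iff.2 fun h => ?_
    by_cases hxa : c x = a
    · by_cases hya : c y = a
      · -- retract the leaves onto their neighbours in the fibre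
        have hnbr : ∀ v : (fibreSubgraph H c a).verts, ∃ w, c w = a ∧
            (c v.1 = a → w = v.1) ∧ (c v.1 ≠ a → H.Adj v.1 w) := by
          rintro ⟨v, hv⟩
          by_cases hva : c v = a
          · exact ⟨v, hva, fun _ => rfl, fun h => absurd hva h⟩
          · obtain ⟨w, hw, hvw⟩ := hv.resolve_left hva
            exact ⟨w, hw, fun h => absurd h hva, fun _ => hvw⟩
        choose f hfa hfin hfout using hnbr
        have key : ∀ u v : (fibreSubgraph H c a).verts, H.Adj u.1 v.1 → c u.1 = a →
            c v.1 ≠ a → f v = u.1 := by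
          intro u v huv hu hv
          have hvR : v.1 ∈ R := by
            by_contra hvR
            exact hv (mem_of_mem_fibreSubgraph hc hS haR v.2 hvR)
          exact hleaf v.1 _ _ hvR (hc.notMem haR (hfa v)) (hc.notMem haR hu)
            ((hfa v).trans hu.symm) (hfout v hv) huv.symm
        refine hbridge x y ⟨hxy.1, hxa.trans hya.symm⟩ ?_
        have h' := reachable_of_step (G' := (fibreGraph H c).deleteEdges {s(x, y)}) f
          (fun u v huv => ?_) h
        · rwa [hfin _ hxa, hfin _ hya] at h'
        · obtain ⟨h1, h2⟩ := deleteEdges_adj.1 huv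
          have h1 : H.Adj u.1 v.1 ∧ (c u.1 = a ∨ c v.1 = a) := h1
          by_cases hu : c u.1 = a
          · rw [hfin u hu]
            by_cases hv : c v.1 = a
            · rw [hfin v hv]
              refine Adj.reachable (deleteEdges_adj.2 ⟨⟨h1.1, hu.trans hv.symm⟩, fun he => h2 ?_⟩)
              rcases Sym2.eq_iff.1 (Set.mem_singleton_iff.1 he) with ⟨h3, h4⟩ | ⟨h3, h4⟩
              · exact Set.mem_singleton_iff.2 (Sym2.eq_iff.2 (.inl ⟨Subtype.ext h3, Subtype.ext h4⟩))
              · exact Set.mem_singleton_iff.2 (Sym2.eq_iff.2 (.inr ⟨Subtype.ext h3, Subtype.ext h4⟩))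
            · rw [key u v h1.1 hu hv]
          · have hv := h1.2.resolve_left hu
            rw [hfin v hv, key v u h1.1.symm hv hu]
      · exact hout x y hx hy hxy.1 hxa hya h.symm
    · refine hout y x hy hx hxy.1.symm (hxy.2.resolve_left hxa) hxa ?_
      rwa [Sym2.eq_swap]

/-- Any minimal feasible VC-SNDP solution `H` with maximum demand at most `3`
decomposes into trees `T₁, …, T_b` that pairwise share only terminals, whose
leaves are terminals and whose internal vertices are Steiner vertices; moreover
for every terminal pair there are `d s t` internally vertex-disjoint paths in
`H` such that each tree's edge set meets the edge set of at most one of these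
paths. -/
theorem vc_minimal_solution_tree_partition {V : Type*} [Fintype V] [DecidableEq V]
    (G H : SimpleGraph V) (R : Set V) (d : V → V → ℕ)
    (hdmax : ∀ s ∈ R, ∀ t ∈ R, d s t ≤ 3)
    (hHG : H ≤ G)
    (hfeas : VCFeasible H R d)
    (hmin : ∀ e ∈ H.edgeSet, ¬ VCFeasible (H.deleteEdges {e}) R d) :
    ∃ (b : ℕ) (T : Fin b → H.Subgraph),
      (∀ i, ((T i).coe).IsTree) ∧
      (H.edgeSet = ⋃ i, (T i).edgeSet) ∧
      (∀ i j, i ≠ j → ∀ v, v ∈ (T i).verts → v ∈ (T j).verts → v ∈ R) ∧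
      (∀ i, ∀ v ∈ (T i).verts, ((T i).neighborSet v).ncard = 1 → v ∈ R) ∧
      (∀ i, ∀ v ∈ (T i).verts, 2 ≤ ((T i).neighborSet v).ncard → v ∉ R) ∧
      (∀ s ∈ R, ∀ t ∈ R, s ≠ t → ∃ P : Fin (d s t) → H.Walk s t,
        IntDisjPaths H s t (d s t) P ∧
        ∀ i : Fin b, {j | ∃ e ∈ (P j).edges, e ∈ (T i).edgeSet}.Subsingleton) := by
  obtain ⟨c, hc, hq, hS⟩ := exists_maximal_contraction hdmax hfeas hmin
  have hleaf : ∀ r x y, r ∈ R → x ∉ R → y ∉ R → c x = c y → H.Adj r x → H.Adj r y → x = y := by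
    intro r x y hr hx hy hcxy hrx hry
    by_contra hne
    have hcr : c r ≠ c x := fun h => hc.map_notMem x hx (h ▸ (hc.map_mem r hr).symm ▸ hr)
    exact hc.not_delete hmin hq hrx (fun h => hx h.2) (fun h => absurd h hcr) fun _ =>
      ⟨r, y, rfl, hcxy.symm, hry, fun h => hy h.2, fun h => hne (Sym2.congr_right.1 h).symm⟩
  have hbridge : ∀ x y, (fibreGraph H c).Adj x y →
      ¬ ((fibreGraph H c).deleteEdges {s(x, y)}).Reachable x y := by
    intro x y hxy h
    refine hc.not_delete hmin hq hxy.1 (fun hR => hxy.1.ne ?_) (fun _ => h.mono ?_)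
      fun h => absurd hxy.2 h
    · rw [← hc.map_mem x hR.1, hxy.2, hc.map_mem y hR.2]
    · refine SimpleGraph.le_iff_adj.2 fun u v huv => ?_
      obtain ⟨h1, h2⟩ := deleteEdges_adj.1 huv
      exact ⟨deleteEdges_adj.2 ⟨h1.1, h2⟩, h1.2⟩
  let ι := {a // a ∈ Set.range c ∧ a ∉ R} ⊕ {e : Sym2 V // e ∈ H.edgeSet ∧ ∀ z ∈ e, z ∈ R}
  let T : ι → H.Subgraph :=
    Sum.elim (fun a => fibreSubgraph H c a.1) fun e => edgeSubgraph H e.1 e.2.1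
  obtain ⟨b, ⟨φ⟩⟩ := Finite.exists_equiv_fin ι
  suffices hT : (∀ i, (T i).coe.IsTree) ∧ (∀ e, e ∈ H.edgeSet ↔ ∃ i, e ∈ (T i).edgeSet) ∧
      (∀ i j, ∀ v, v ∈ (T i).verts → v ∈ (T j).verts → v ∉ R → i = j) ∧
      (∀ i, ∀ v ∈ (T i).verts, ((T i).neighborSet v).ncard = 1 → v ∈ R) ∧
      (∀ i, ∀ v ∈ R, ((T i).neighborSet v).Subsingleton) ∧
      (∀ s ∈ R, ∀ t ∈ R, s ≠ t → ∃ P : Fin (d s t) → H.Walk s t,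
        IntDisjPaths H s t (d s t) P ∧
        ∀ i, {j | ∃ e ∈ (P j).edges, e ∈ (T i).edgeSet}.Subsingleton) by
    obtain ⟨h1, h2, h3, h4, h5, h6⟩ := hT
    refine ⟨b, T ∘ φ.symm, fun i => h1 _, ?_, fun i j hij v hi hj => ?_, fun i => h4 _,
      fun i v _ hv hR => ?_, fun s hs t ht hst => ?_⟩
    · ext e
      rw [h2, Set.mem_iUnion]
      exact φ.symm.surjective.exists
    · by_contra hR
      exact hij (φ.symm.injective (h3 _ _ v hi hj hR))
    · have := (Set.ncard_le_one (Set.toFinite _)).2 fun x hx y hy => h5 (φ.symm i) v hR hx hy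
      exact absurd hv (by simpa using this)
    · obtain ⟨P, hP, hP'⟩ := h6 s hs t ht hst
      exact ⟨P, hP, fun i => hP' _⟩
  refine ⟨?_, fun e => ?_, ?_, ?_, ?_, fun s hs t ht hst => ?_⟩
  · rintro (a | e)
    · exact isTree_fibreSubgraph hc hS hleaf hbridge a.2.1 a.2.2
    · exact isTree_edgeSubgraph e.2.1
  · refine ⟨fun he => ?_, fun ⟨i, hi⟩ => (T i).edgeSet_subset hi⟩
    by_cases hR : ∀ z ∈ e, z ∈ R
    · refine ⟨.inr ⟨e, he, hR⟩, ?_⟩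
      induction e with | _ x y => ?_
      exact (rfl : s(x, y) = s(x, y))
    · push Not at hR
      obtain ⟨x, hx, hxR⟩ := hR
      obtain ⟨y, rfl⟩ := Sym2.mem_iff_exists.1 hx
      exact ⟨.inl ⟨c x, ⟨x, rfl⟩, hc.map_notMem x hxR⟩, ⟨he, Or.inl rfl⟩⟩
  · rintro (a | e) (a' | e') v hv hv' hR
    · have h1 := mem_of_mem_fibreSubgraph hc hS a.2.2 hv hR
      have h2 := mem_of_mem_fibreSubgraph hc hS a'.2.2 hv' hR
      exact congrArg Sum.inl (Subtype.ext (h1.symm.trans h2))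
    · exact absurd (e'.2.2 v hv') hR
    · exact absurd (e.2.2 v hv) hR
    · exact absurd (e.2.2 v hv) hR
  · rintro (a | e) v hv h1
    · by_contra hR
      have hva := mem_of_mem_fibreSubgraph hc hS a.2.2 hv hR
      obtain ⟨x, hx⟩ := Set.ncard_eq_one.1 h1
      have hvx : x ∈ (fibreSubgraph H c a.1).neighborSet v :=
        hx.symm ▸ Set.mem_singleton x
      refine not_leaf hfeas hmin hR hvx.1 fun y hy => ?_
      have hvy : y ∈ (fibreSubgraph H c a.1).neighborSet v := ⟨hy, Or.inl hva⟩
      exact Set.mem_singleton_iff.1 (hx ▸ hvy)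
    · exact e.2.2 v hv
  · rintro (a | e) v hv x hx y hy
    · have hca : c v ≠ a.1 := fun h => hc.notMem a.2.2 h hv
      have hxa : c x = a.1 := hx.2.resolve_left hca
      have hya : c y = a.1 := hy.2.resolve_left hca
      exact hleaf v x y hv (hc.notMem a.2.2 hxa) (hc.notMem a.2.2 hya) (hxa.trans hya.symm)
        hx.1 hy.1
    · have hx : s(v, x) = e.1 := hx
      have hy : s(v, y) = e.1 := hy
      exact Sym2.congr_right.1 (hx.trans hy.symm)
  · obtain ⟨P, hP, hsep⟩ := hc.exists_paths hs ht hst (hq s hs t ht hst)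
    refine ⟨P, hP, ?_⟩
    rintro (a | e) i ⟨e₁, he₁, hT₁⟩ j ⟨e₂, he₂, hT₂⟩
    · have key : ∀ i, ∀ e ∈ (P i).edges, e ∈ (fibreSubgraph H c a.1).edgeSet →
          ∃ x ∈ (P i).support, c x = a.1 := by
        intro i e he hT
        induction e with | _ x y => ?_
        rcases hT.2 with h | h
        · exact ⟨x, (P i).fst_mem_support_of_mem_edges he, h⟩
        · exact ⟨y, (P i).snd_mem_support_of_mem_edges he, h⟩
      by_contra hij
      obtain ⟨x, hx, hxa⟩ := key i e₁ he₁ hT₁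
      obtain ⟨y, hy, hya⟩ := key j e₂ he₂ hT₂
      rcases hsep i j hij x hx y hy (hxa.trans hya.symm) with h | h
      · exact a.2.2 (hxa ▸ h ▸ hs)
      · exact a.2.2 (hxa ▸ h ▸ ht)
    · have key : ∀ e', e' ∈ (edgeSubgraph H e.1 e.2.1).edgeSet → e' = e.1 := by
        intro e' h
        induction e' with | _ x y => exact h
      obtain rfl := key e₁ hT₁
      have := key e₂ hT₂
      exact hP.eq_of_mem_edges he₁ (this ▸ he₂)
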